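/- Let 0 < λ ≤ 1. Define c_0 = 1 and c_k = (c_{k−1} − λ·3^{−k})/2 for k ≥ 1 (so that at step k an open interval of length λ/3^k is removed from the center of each of the 2^{k−1} remaining closed intervals). Then the λ-fat Cantor set C_λ = E(c) has Lebesgue measure 1 − λ. -/

import Mathlib

open MeasureTheory

/-- The set `F n` of left endpoints at stage `n` of the symmetric Cantor construction
determined by the sequence `c`: sums `∑_{j=1}^n ε_j r_j` with `ε_j ∈ {0,1}` and
`r_j = c (j-1) - c j`. -/
def symF (c : ℕ → ℝ) (n : ℕ) : Set ℝ :=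
  {t : ℝ | ∃ ε : ℕ → ℕ, (∀ j, ε j ≤ 1) ∧
    t = ∑ j ∈ Finset.Icc 1 n, (ε j : ℝ) * (c (j - 1) - c j)}

/-- Stage `n` of the symmetric Cantor construction: `E_n = ⋃_{t ∈ F_n} [t, t + c_n]`. -/
def symStage (c : ℕ → ℝ) (n : ℕ) : Set ℝ := ⋃ t ∈ symF c n, Set.Icc t (t + c n)

/-- The symmetric Cantor set `E(c) = ⋂_n E_n` determined by the sequence `c`. -/
def symCantorSet (c : ℕ → ℝ) : Set ℝ := ⋂ n, symStage c n

theorem mem_symStage_iff {c : ℕ → ℝ} {n : ℕ} {x : ℝ} :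
    x ∈ symStage c n ↔ ∃ ε : ℕ → ℕ, (∀ j, ε j ≤ 1) ∧
      ∑ j ∈ Finset.range n, (ε j : ℝ) * (c j - c (j + 1)) ≤ x ∧
      x ≤ ∑ j ∈ Finset.range n, (ε j : ℝ) * (c j - c (j + 1)) + c n := by
  have reindex (ε : ℕ → ℕ) : ∑ j ∈ Finset.Icc 1 n, (ε j : ℝ) * (c (j - 1) - c j) =
      ∑ j ∈ Finset.range n, (ε (j + 1) : ℝ) * (c j - c (j + 1)) := by
    rw [← Finset.Ico_add_one_right_eq_Icc, Finset.sum_Ico_eq_sum_range]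
    simp [add_comm 1]
  simp only [symStage, symF, Set.mem_iUnion, Set.mem_ofPred_eq, Set.mem_Icc, exists_prop]
  constructor
  · rintro ⟨t, ⟨ε, hε, rfl⟩, hx⟩
    rw [reindex] at hx
    exact ⟨fun j => ε (j + 1), fun j => hε _, hx⟩
  · rintro ⟨ε, hε, hx⟩
    refine ⟨_, ⟨fun j => ε (j - 1), fun j => hε _, rfl⟩, ?_⟩
    rw [reindex]
    simpa using hx

theorem symStage_zero (c : ℕ → ℝ) : symStage c 0 = Set.Icc 0 (c 0) := by
  ext x
  simp only [mem_symStage_iff, Finset.range_zero, Finset.sum_empty, zero_add, Set.mem_Icc]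
  exact ⟨fun ⟨_, _, h⟩ => h, fun h => ⟨0, by simp, h⟩⟩

/-- Self-similarity: stage `n + 1` consists of two translated copies of stage `n` of the
construction for the shifted sequence. -/
theorem symStage_succ (c : ℕ → ℝ) (n : ℕ) :
    symStage c (n + 1) = symStage (fun k => c (k + 1)) n ∪
      (fun x => -(c 0 - c 1) + x) ⁻¹' symStage (fun k => c (k + 1)) n := by
  ext x
  simp only [Set.mem_union, Set.mem_preimage, mem_symStage_iff, Finset.sum_range_succ' _ n]
  constructor
  · rintro ⟨ε, hε, h₁, h₂⟩
    rcases Nat.le_one_iff_eq_zero_or_eq_one.mp (hε 0) with h | h <;>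
      simp only [h, Nat.cast_zero, Nat.cast_one, zero_add] at h₁ h₂
    · exact Or.inl ⟨fun j => ε (j + 1), fun j => hε _, by linarith, by linarith⟩
    · exact Or.inr ⟨fun j => ε (j + 1), fun j => hε _, by linarith, by linarith⟩
  · rintro (⟨ε, hε, h₁, h₂⟩ | ⟨ε, hε, h₁, h₂⟩)
    · refine ⟨fun j => if j = 0 then 0 else ε (j - 1), fun j => ?_, ?_⟩
      · cases j <;> simp [hε]
      · constructor <;> simp <;> linarith
    · refine ⟨fun j => if j = 0 then 1 else ε (j - 1), fun j => ?_, ?_⟩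
      · cases j <;> simp [hε]
      · constructor <;> simp <;> linarith

theorem measurableSet_symStage (c : ℕ → ℝ) (n : ℕ) : MeasurableSet (symStage c n) := by
  induction n generalizing c with
  | zero => rw [symStage_zero]; exact measurableSet_Icc
  | succ n ih =>
    rw [symStage_succ]
    exact (ih _).union (measurable_const_add _ (ih _))

theorem symStage_subset_Icc {c : ℕ → ℝ} (hc : Antitone c) (n : ℕ) :
    symStage c n ⊆ Set.Icc 0 (c 0) := by
  induction n generalizing c with
  | zero => rw [symStage_zero]
  | succ n ih =>
    have h01 : c 1 ≤ c 0 := hc zero_le_one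
    have hsub := ih (c := fun k => c (k + 1)) fun a b h => hc (Nat.succ_le_succ h)
    rw [symStage_succ]
    rintro x (hx | hx) <;> obtain ⟨h₁, h₂⟩ := hsub hx <;> constructor <;>
      simp only [zero_add] at h₁ h₂ <;> linarith

theorem antitone_symStage {c : ℕ → ℝ} (hc : Antitone c) : Antitone (symStage c) := by
  refine antitone_nat_of_succ_le fun n => ?_
  induction n generalizing c with
  | zero => rw [symStage_zero]; exact symStage_subset_Icc hc 1
  | succ n ih =>
    have hsub := ih (c := fun k => c (k + 1)) fun a b h => hc (Nat.succ_le_succ h)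
    rw [symStage_succ c (n + 1), symStage_succ c n]
    exact Set.union_subset_union hsub (Set.preimage_mono hsub)

theorem volume_symStage {c : ℕ → ℝ} (hc : Antitone c) (hgap : ∀ n, 2 * c (n + 1) < c n) (n : ℕ) :
    volume (symStage c n) = 2 ^ n * ENNReal.ofReal (c n) := by
  induction n generalizing c with
  | zero => simp [symStage_zero]
  | succ n ih =>
    have hc' : Antitone fun k => c (k + 1) := fun a b h => hc (Nat.succ_le_succ h)
    have hdisj : Disjoint (symStage (fun k => c (k + 1)) n)
        ((fun x => -(c 0 - c 1) + x) ⁻¹' symStage (fun k => c (k + 1)) n) := by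
      refine Set.disjoint_left.mpr fun x hx hx' => ?_
      have h₁ := (symStage_subset_Icc hc' n hx).2
      have h₂ := (symStage_subset_Icc hc' n hx').1
      have := hgap 0
      simp only [zero_add] at h₁ h₂ this
      linarith
    rw [symStage_succ, measure_union hdisj (measurable_const_add _ (measurableSet_symStage _ n)),
      measure_preimage_add, ih hc' fun k => hgap (k + 1)]
    ring

/-- The measure of a symmetric Cantor set is the limit of the total lengths `2 ^ n * c n`. -/
theorem volume_symCantorSet_of_tendsto {c : ℕ → ℝ} {a : ℝ} (hc : Antitone c)
    (hgap : ∀ n, 2 * c (n + 1) < c n)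
    (ha : Filter.Tendsto (fun n => 2 ^ n * c n) Filter.atTop (nhds a)) :
    volume (symCantorSet c) = ENNReal.ofReal a := by
  have hlim : Filter.Tendsto (fun n => volume (symStage c n)) Filter.atTop
      (nhds (volume (symCantorSet c))) :=
    tendsto_measure_iInter_atTop (fun n => (measurableSet_symStage c n).nullMeasurableSet)
      (antitone_symStage hc) ⟨0, by simp [symStage_zero]⟩
  refine tendsto_nhds_unique hlim ((ENNReal.tendsto_ofReal ha).congr fun n => ?_)
  rw [volume_symStage hc hgap, ENNReal.ofReal_mul (by positivity),
    ENNReal.ofReal_pow zero_le_two, ENNReal.ofReal_ofNat]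

/-- The `λ`-fat Cantor set, `0 < λ ≤ 1`, obtained by removing at step `k` a centered
open interval of length `λ/3^k` from each remaining closed interval, has Lebesgue
measure `1 - λ`. -/
theorem volume_fatCantorSet (l : ℝ) (hl0 : 0 < l) (hl1 : l ≤ 1) (c : ℕ → ℝ)
    (hc0 : c 0 = 1) (hc : ∀ k : ℕ, 1 ≤ k → c k = (c (k - 1) - l / 3 ^ k) / 2) :
    volume (symCantorSet c) = ENNReal.ofReal (1 - l) := by
  have hstep (n : ℕ) : c (n + 1) = (c n - l / 3 ^ (n + 1)) / 2 := hc (n + 1) (by omega)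
  have hlen (n : ℕ) : 2 ^ n * c n = (1 - l) + l * (2 / 3) ^ n := by
    induction n with
    | zero => simp [hc0]
    | succ n ih =>
      have : 2 ^ (n + 1) * c (n + 1) = 2 ^ n * c n - l * (2 / 3) ^ n / 3 := by
        rw [hstep, div_pow]
        field_simp
        ring
      rw [this, ih]
      ring
  have hpos (n : ℕ) : 0 < c n := by
    have : 0 < 2 ^ n * c n := by
      rw [hlen]
      exact add_pos_of_nonneg_of_pos (by linarith) (by positivity)
    exact pos_of_mul_pos_right this (by positivity)
  have hgap (n : ℕ) : 2 * c (n + 1) < c n := by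
    have : 0 < l / 3 ^ (n + 1) := by positivity
    linarith [hstep n]
  have hanti : Antitone c := antitone_nat_of_succ_le fun n => by
    linarith [hgap n, hpos (n + 1)]
  refine volume_symCantorSet_of_tendsto hanti hgap ?_
  simp only [hlen]
  simpa using ((tendsto_pow_atTop_nhds_zero_of_lt_one (r := (2 / 3 : ℝ)) (by norm_num)
    (by norm_num)).const_mul l).const_add (1 - l)
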